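/- Let w = α₁ e₁∧e₂ + α₂ e₃∧e₄ + α₃ e₅∧e₆ ∈ so(7) and K = α₁ J₁J₂ + α₂ J₃J₄ + α₃ J₅J₆ ∈ so(8), where J₁,…,J₇ are pairwise anticommuting orthogonal complex structures on ℝ⁸. Then K² has eigenvalues −(α₁ ± α₂ ± α₃)², each eigenspace of multiplicity 2 (counting each sign combination); in particular K is invertible iff α₁ ± α₂ ± α₃ ≠ 0 for all four sign choices. -/

import Mathlib

open Matrix Polynomial

lemma stmt18_prod (P Q : Matrix (Fin 8) (Fin 8) ℝ) (hP : P * P = 1) (hQ : Q * Q = 1)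
    (hc : Q * P = P * Q) (t u v w : ℝ) :
    ((t • 1 + u • P + v • Q + w • (P * Q)) * (t • 1 - u • P - v • Q + w • (P * Q))) *
    ((t • 1 - u • P + v • Q - w • (P * Q)) * (t • 1 + u • P - v • Q - w • (P * Q))) =
    ((t + u + v + w) * (t - u - v + w) * (t - u + v - w) * (t + u - v - w)) •
      (1 : Matrix (Fin 8) (Fin 8) ℝ) := by
  have h1 : P * (P * Q) = Q := by rw [← mul_assoc, hP, one_mul]
  have h2 : Q * (P * Q) = P := by rw [← mul_assoc, hc, mul_assoc, hQ, mul_one]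
  have h3 : (P * Q) * P = Q := by rw [mul_assoc, hc, h1]
  have h4 : (P * Q) * Q = P := by rw [mul_assoc, hQ, mul_one]
  have h5 : (P * Q) * (P * Q) = 1 := by rw [mul_assoc, h2, hP]
  have e1 : (t • 1 + u • P + v • Q + w • (P * Q)) * (t • 1 - u • P - v • Q + w • (P * Q)) =
      (t ^ 2 + w ^ 2 - u ^ 2 - v ^ 2) • (1 : Matrix (Fin 8) (Fin 8) ℝ)
        + (2 * (t * w - u * v)) • (P * Q) := by
    simp only [mul_add, add_mul, mul_sub, sub_mul, smul_mul_assoc, mul_smul_comm, one_mul, mul_one,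
      hP, hQ, hc, h1, h2, h3, h4, h5]
    module
  have e2 : (t • 1 - u • P + v • Q - w • (P * Q)) * (t • 1 + u • P - v • Q - w • (P * Q)) =
      (t ^ 2 + w ^ 2 - u ^ 2 - v ^ 2) • (1 : Matrix (Fin 8) (Fin 8) ℝ)
        - (2 * (t * w - u * v)) • (P * Q) := by
    simp only [mul_add, add_mul, mul_sub, sub_mul, smul_mul_assoc, mul_smul_comm, one_mul, mul_one,
      hP, hQ, hc, h1, h2, h3, h4, h5]
    module
  rw [e1, e2]
  simp only [add_mul, mul_sub, smul_mul_assoc, mul_smul_comm, one_mul, mul_one, h5]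
  module

lemma stmt18_conj (S M N : Matrix (Fin 8) (Fin 8) ℝ) (hS : S * S = -1) (h : S * M = N * S) :
    N.det = M.det := by
  have hd : S.det * S.det = 1 := by
    rw [← det_mul, hS, det_neg]; norm_num
  have hne : S.det ≠ 0 := by
    intro h0; simp [h0] at hd
  have := congrArg det h
  rw [det_mul, det_mul, mul_comm] at this
  exact (mul_right_cancel₀ hne this).symm

lemma stmt18_pow (p q : ℝ[X]) (hp : p.Monic) (hq : q.Monic) (h : p ^ 4 = q ^ 4) : p = q := by
  refine eq_of_monic_of_associated hp hq ?_
  apply associated_of_dvd_dvd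
  · exact (IsIntegrallyClosed.pow_dvd_pow_iff (by norm_num)).1 h.dvd
  · exact (IsIntegrallyClosed.pow_dvd_pow_iff (by norm_num)).1 h.symm.dvd

lemma stmt18_pass (S U V : Matrix (Fin 8) (Fin 8) ℝ) (h1 : S * U = -(U * S))
    (h2 : S * V = -(V * S)) : S * (U * V) = (U * V) * S := by
  rw [← mul_assoc, h1, neg_mul, mul_assoc, h2, mul_neg, neg_neg, mul_assoc]

lemma stmt18_flip (S V : Matrix (Fin 8) (Fin 8) ℝ)
    (h2 : S * V = -(V * S)) : S * (S * V) = -((S * V) * S) := by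
  rw [mul_assoc S V S, ← neg_eq_iff_eq_neg.mpr h2, mul_neg, neg_neg]

lemma stmt18_sq (S V : Matrix (Fin 8) (Fin 8) ℝ) (hS : S * S = -1) (hV : V * V = -1)
    (h2 : S * V = -(V * S)) : (S * V) * (S * V) = -1 := by
  rw [← mul_assoc, mul_assoc S V S, ← neg_eq_iff_eq_neg.mpr h2, mul_neg, ← mul_assoc S S V, hS]
  simp [hV]

set_option maxHeartbeats 1000000 in
/-- For pairwise anticommuting orthogonal complex structures `J₁, …, J₇` on `ℝ⁸` and
`K = α₁ J₁J₂ + α₂ J₃J₄ + α₃ J₅J₆`, the operator `K²` has eigenvalues `−(α₁ ± α₂ ± α₃)²`,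
each with multiplicity `2` (so its characteristic polynomial is the square of the product
of the four corresponding linear factors); in particular `K` is invertible iff
`α₁ ± α₂ ± α₃ ≠ 0` for all four sign choices.  (Here `J i` denotes `J_{i+1}`.) -/
theorem stmt18 (J : Fin 7 → Matrix (Fin 8) (Fin 8) ℝ)
    (hskew : ∀ i, (J i)ᵀ = -(J i))
    (hsq : ∀ i, J i * J i = -1)
    (hanti : ∀ i j, i ≠ j → J i * J j = -(J j * J i))
    (α₁ α₂ α₃ : ℝ)
    (K : Matrix (Fin 8) (Fin 8) ℝ)
    (hK : K = α₁ • (J 0 * J 1) + α₂ • (J 2 * J 3) + α₃ • (J 4 * J 5)) :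
    (K * K).charpoly =
      ((X + C ((α₁ + α₂ + α₃) ^ 2)) * (X + C ((α₁ + α₂ - α₃) ^ 2)) *
        (X + C ((α₁ - α₂ + α₃) ^ 2)) * (X + C ((α₁ - α₂ - α₃) ^ 2))) ^ 2 ∧
    (IsUnit K ↔ (α₁ + α₂ + α₃ ≠ 0 ∧ α₁ + α₂ - α₃ ≠ 0 ∧
      α₁ - α₂ + α₃ ≠ 0 ∧ α₁ - α₂ - α₃ ≠ 0)) := by
  obtain ⟨A, hA⟩ : ∃ A, A = J 0 * J 1 := ⟨_, rfl⟩
  obtain ⟨B, hB⟩ : ∃ A, A = J 2 * J 3 := ⟨_, rfl⟩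
  obtain ⟨D, hD⟩ : ∃ A, A = J 4 * J 5 := ⟨_, rfl⟩
  have hAA : A * A = -1 := by rw [hA]; exact stmt18_sq _ _ (hsq _) (hsq _) (hanti 0 1 (by decide))
  have hBB : B * B = -1 := by rw [hB]; exact stmt18_sq _ _ (hsq _) (hsq _) (hanti 2 3 (by decide))
  have hDD : D * D = -1 := by rw [hD]; exact stmt18_sq _ _ (hsq _) (hsq _) (hanti 4 5 (by decide))
  have a0 : J 0 * A = -(A * J 0) := by rw [hA]; exact stmt18_flip _ _ (hanti 0 1 (by decide))
  have b0 : J 0 * B = B * J 0 := by rw [hB]; exact stmt18_pass _ _ _ (hanti 0 2 (by decide)) (hanti 0 3 (by decide))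
  have d0 : J 0 * D = D * J 0 := by rw [hD]; exact stmt18_pass _ _ _ (hanti 0 4 (by decide)) (hanti 0 5 (by decide))
  have a2 : J 2 * A = A * J 2 := by rw [hA]; exact stmt18_pass _ _ _ (hanti 2 0 (by decide)) (hanti 2 1 (by decide))
  have b2 : J 2 * B = -(B * J 2) := by rw [hB]; exact stmt18_flip _ _ (hanti 2 3 (by decide))
  have d2 : J 2 * D = D * J 2 := by rw [hD]; exact stmt18_pass _ _ _ (hanti 2 4 (by decide)) (hanti 2 5 (by decide))
  have a4 : J 4 * A = A * J 4 := by rw [hA]; exact stmt18_pass _ _ _ (hanti 4 0 (by decide)) (hanti 4 1 (by decide))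
  have b4 : J 4 * B = B * J 4 := by rw [hB]; exact stmt18_pass _ _ _ (hanti 4 2 (by decide)) (hanti 4 3 (by decide))
  have d4 : J 4 * D = -(D * J 4) := by rw [hD]; exact stmt18_flip _ _ (hanti 4 5 (by decide))
  have a3 : J 3 * A = A * J 3 := by rw [hA]; exact stmt18_pass _ _ _ (hanti 3 0 (by decide)) (hanti 3 1 (by decide))
  have a5 : J 5 * A = A * J 5 := by rw [hA]; exact stmt18_pass _ _ _ (hanti 5 0 (by decide)) (hanti 5 1 (by decide))
  have b5 : J 5 * B = B * J 5 := by rw [hB]; exact stmt18_pass _ _ _ (hanti 5 2 (by decide)) (hanti 5 3 (by decide))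
  have hBA : B * A = A * B := by rw [hB, mul_assoc, a3, ← mul_assoc, a2, mul_assoc]
  have hDA : D * A = A * D := by rw [hD, mul_assoc, a5, ← mul_assoc, a4, mul_assoc]
  have hDB : D * B = B * D := by rw [hD, mul_assoc, b5, ← mul_assoc, b4, mul_assoc]
  rw [← hA, ← hB, ← hD] at hK
  obtain ⟨P, hP⟩ : ∃ P, P = A * B := ⟨_, rfl⟩
  obtain ⟨Q, hQ⟩ : ∃ P, P = A * D := ⟨_, rfl⟩
  have hPQ : P * Q = -(B * D) := by
    rw [hP, hQ, ← hBA, mul_assoc, ← mul_assoc A A D, hAA]; simp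
  have hQP : Q * P = P * Q := by
    rw [hPQ, hP, hQ, ← hDA, mul_assoc, ← mul_assoc A A B, hAA]; simp [hDB]
  have hPP : P * P = 1 := by
    rw [hP]; nth_rewrite 1 [← hBA]
    rw [mul_assoc, ← mul_assoc A A B, hAA]; simp [hBB]
  have hQQ : Q * Q = 1 := by
    rw [hQ]; nth_rewrite 1 [← hDA]
    rw [mul_assoc, ← mul_assoc A A D, hAA]; simp [hDD]
  have p0 : J 0 * P = -(P * J 0) := by
    rw [hP, ← mul_assoc, a0, neg_mul, mul_assoc, b0, mul_assoc]
  have q0 : J 0 * Q = -(Q * J 0) := by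
    rw [hQ, ← mul_assoc, a0, neg_mul, mul_assoc, d0, mul_assoc]
  have p2 : J 2 * P = -(P * J 2) := by
    rw [hP, ← mul_assoc, a2, mul_assoc, b2, mul_neg, mul_assoc]
  have q2 : J 2 * Q = Q * J 2 := by
    rw [hQ, ← mul_assoc, a2, mul_assoc, d2, mul_assoc]
  have p4 : J 4 * P = P * J 4 := by
    rw [hP, ← mul_assoc, a4, mul_assoc, b4, mul_assoc]
  have q4 : J 4 * Q = -(Q * J 4) := by
    rw [hQ, ← mul_assoc, a4, mul_assoc, d4, mul_neg, mul_assoc]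
  have r0 : J 0 * (P * Q) = (P * Q) * J 0 := stmt18_pass _ _ _ p0 q0
  have r2 : J 2 * (P * Q) = -((P * Q) * J 2) := by
    rw [← mul_assoc, p2, neg_mul, mul_assoc, q2, mul_assoc]
  have r4 : J 4 * (P * Q) = -((P * Q) * J 4) := by
    rw [← mul_assoc, p4, mul_assoc, q4, mul_neg, mul_assoc]
  have key : (K * K).charpoly =
      ((X + C ((α₁ + α₂ + α₃) ^ 2)) * (X + C ((α₁ + α₂ - α₃) ^ 2)) *
        (X + C ((α₁ - α₂ + α₃) ^ 2)) * (X + C ((α₁ - α₂ - α₃) ^ 2))) ^ 2 := by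
    have hmon : (((X + C ((α₁ + α₂ + α₃) ^ 2)) * (X + C ((α₁ + α₂ - α₃) ^ 2)) *
        (X + C ((α₁ - α₂ + α₃) ^ 2)) * (X + C ((α₁ - α₂ - α₃) ^ 2))) ^ 2).Monic :=
      ((((monic_X_add_C _).mul (monic_X_add_C _)).mul (monic_X_add_C _)).mul
        (monic_X_add_C _)).pow 2
    have h4 : (K * K).charpoly ^ 4 =
      (((X + C ((α₁ + α₂ + α₃) ^ 2)) * (X + C ((α₁ + α₂ - α₃) ^ 2)) *
        (X + C ((α₁ - α₂ + α₃) ^ 2)) * (X + C ((α₁ - α₂ - α₃) ^ 2))) ^ 2) ^ 4 := by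
      apply Polynomial.funext
      intro x
      obtain ⟨t, ht⟩ : ∃ t, t = x + α₁ ^ 2 + α₂ ^ 2 + α₃ ^ 2 := ⟨_, rfl⟩
      obtain ⟨u, hu⟩ : ∃ u, u = -2 * α₁ * α₂ := ⟨_, rfl⟩
      obtain ⟨v, hv⟩ : ∃ u, u = -2 * α₁ * α₃ := ⟨_, rfl⟩
      obtain ⟨w, hw⟩ : ∃ u, u = 2 * α₂ * α₃ := ⟨_, rfl⟩
      have hM : Matrix.scalar (Fin 8) x - K * K =
          t • 1 + u • P + v • Q + w • (P * Q) := by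
        have hs : Matrix.scalar (Fin 8) x = x • (1 : Matrix (Fin 8) (Fin 8) ℝ) := by
          rw [smul_one_eq_diagonal]; rfl
        rw [hs, hK, hPQ, hP, hQ, ht, hu, hv, hw]
        simp only [mul_add, add_mul, smul_mul_assoc, mul_smul_comm, hAA, hBB, hDD, hBA, hDA, hDB]
        module
      have hdet0 : (t • 1 - u • P - v • Q + w • (P * Q)).det =
          (t • 1 + u • P + v • Q + w • (P * Q)).det := by
        apply stmt18_conj (J 0) _ _ (hsq 0)
        simp only [mul_add, add_mul, sub_mul, smul_mul_assoc, mul_smul_comm, one_mul, mul_one,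
          p0, q0, r0]
        module
      have hdet2 : (t • 1 - u • P + v • Q - w • (P * Q)).det =
          (t • 1 + u • P + v • Q + w • (P * Q)).det := by
        apply stmt18_conj (J 2) _ _ (hsq 2)
        simp only [mul_add, add_mul, sub_mul, smul_mul_assoc, mul_smul_comm, one_mul, mul_one,
          p2, q2, r2]
        module
      have hdet4 : (t • 1 + u • P - v • Q - w • (P * Q)).det =
          (t • 1 + u • P + v • Q + w • (P * Q)).det := by
        apply stmt18_conj (J 4) _ _ (hsq 4)
        simp only [mul_add, add_mul, sub_mul, smul_mul_assoc, mul_smul_comm, one_mul, mul_one,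
          p4, q4, r4]
        module
      have hp := congrArg det (stmt18_prod P Q hPP hQQ hQP t u v w)
      rw [det_mul, det_mul, det_mul, hdet0, hdet2, hdet4, det_smul, det_one, ← hM] at hp
      rw [eval_pow, Matrix.eval_charpoly]
      have e : ∀ d : ℝ, d ^ 4 = d * d * (d * d) := fun d => by ring
      have f1 : t + u + v + w = x + (α₁ - α₂ - α₃) ^ 2 := by rw [ht, hu, hv, hw]; ring
      have f2 : t - u - v + w = x + (α₁ + α₂ + α₃) ^ 2 := by rw [ht, hu, hv, hw]; ring
      have f3 : t - u + v - w = x + (α₁ + α₂ - α₃) ^ 2 := by rw [ht, hu, hv, hw]; ring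
      have f4 : t + u - v - w = x + (α₁ - α₂ + α₃) ^ 2 := by rw [ht, hu, hv, hw]; ring
      rw [e, hp, f1, f2, f3, f4]
      simp only [eval_pow, eval_mul, eval_add, eval_X, eval_C, Fintype.card_fin]
      generalize x + (α₁ - α₂ - α₃) ^ 2 = y1
      generalize x + (α₁ + α₂ + α₃) ^ 2 = y2
      generalize x + (α₁ + α₂ - α₃) ^ 2 = y3
      generalize x + (α₁ - α₂ + α₃) ^ 2 = y4
      ring
    exact stmt18_pow _ _ (Matrix.charpoly_monic _) hmon h4
  refine ⟨key, ?_⟩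
  have h0 := congrArg (eval 0) key
  rw [Matrix.eval_charpoly] at h0
  simp only [eval_pow, eval_mul, eval_add, eval_X, eval_C, map_zero, zero_sub, zero_add, det_neg,
    det_mul, Fintype.card_fin] at h0
  rw [Matrix.isUnit_iff_isUnit_det, isUnit_iff_ne_zero]
  have h1 : K.det ≠ 0 ↔ (-1) ^ 8 * (K.det * K.det) ≠ 0 := by simp
  rw [h1, h0]
  simp only [ne_eq, pow_eq_zero_iff, mul_eq_zero, OfNat.ofNat_ne_zero, not_false_eq_true,
    not_or, and_assoc]
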